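/- arXiv:math/0109097 — 2 statements merged into one kernel-verified Lean document; each statement's English description precedes it below -/
import Mathlib

section
/- Fix ε ∈ ℝ. On the domain of points (r,θ,μ,ν) with 0 < r < 1/√(1+ε²) and (μ,ν) ≠ (0,0), the quantity μ² + r²ν² − r²(rν + εμ)² is positive; define F(r,θ,μ,ν) := (√(μ² + r²ν² − r²(rν + εμ)²) + rμ − εr²ν)/(1−(1+ε²)r²). Then F > 0, the fundamental tensor (g_{ij}) of F is positive definite, and the Riemann curvature coefficients of F satisfy R^i_k = −(1/4)(F²δ^i_k − F(∂F/∂y^k)y^i) for all i, k ∈ {1,2}; that is, F has constant flag curvature K = −1/4. -/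
noncomputable section

/-- Partial derivative in the base coordinate `x^i` of a function of `(x, y)`. -/
def pdx (i : Fin 2) (f : (Fin 2 → ℝ) → (Fin 2 → ℝ) → ℝ) :
    (Fin 2 → ℝ) → (Fin 2 → ℝ) → ℝ :=
  fun x y => deriv (fun t => f (Function.update x i t) y) (x i)

/-- Partial derivative in the fibre coordinate `y^i` of a function of `(x, y)`. -/
def pdy (i : Fin 2) (f : (Fin 2 → ℝ) → (Fin 2 → ℝ) → ℝ) :
    (Fin 2 → ℝ) → (Fin 2 → ℝ) → ℝ :=
  fun x y => deriv (fun t => f x (Function.update y i t)) (y i)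

/-- The fundamental tensor `g_{ij} = ½ ∂²(F²)/∂y^i∂y^j` of a Finsler metric `F`. -/
def fundTensor (F : (Fin 2 → ℝ) → (Fin 2 → ℝ) → ℝ) (i j : Fin 2) :
    (Fin 2 → ℝ) → (Fin 2 → ℝ) → ℝ :=
  fun x y => (1 / 2) * pdy i (pdy j fun x y => F x y ^ 2) x y

/-- The fundamental tensor as a matrix. -/
def fundMatrix (F : (Fin 2 → ℝ) → (Fin 2 → ℝ) → ℝ) (x y : Fin 2 → ℝ) :
    Matrix (Fin 2) (Fin 2) ℝ :=
  Matrix.of fun i j => fundTensor F i j x y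

/-- The geodesic (spray) coefficients
`G^i = ¼ g^{ik}(2 ∂g_{pk}/∂x^q − ∂g_{pq}/∂x^k) y^p y^q`. -/
def sprayCoeff (F : (Fin 2 → ℝ) → (Fin 2 → ℝ) → ℝ) (i : Fin 2) :
    (Fin 2 → ℝ) → (Fin 2 → ℝ) → ℝ :=
  fun x y => (1 / 4) * ∑ k, (fundMatrix F x y)⁻¹ i k *
    ∑ p, ∑ q, (2 * pdx q (fundTensor F p k) x y - pdx k (fundTensor F p q) x y) * y p * y q

/-- The Riemann curvature coefficients
`R^i_k = 2∂G^i/∂x^k − y^j ∂²G^i/∂x^j∂y^k + 2G^j ∂²G^i/∂y^j∂y^k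
  − (∂G^i/∂y^j)(∂G^j/∂y^k)`. -/
def riemCoeff (F : (Fin 2 → ℝ) → (Fin 2 → ℝ) → ℝ) (i k : Fin 2) :
    (Fin 2 → ℝ) → (Fin 2 → ℝ) → ℝ :=
  fun x y =>
    2 * pdx k (sprayCoeff F i) x y
      - ∑ j, y j * pdx j (pdy k (sprayCoeff F i)) x y
      + 2 * ∑ j, sprayCoeff F j x y * pdy j (pdy k (sprayCoeff F i)) x y
      - ∑ j, pdy j (sprayCoeff F i) x y * pdy k (sprayCoeff F j) x y

end

/-- The navigation domain, in the coordinates `(r, μ, ν)` the metric depends on. -/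
noncomputable def NavDomain (ε r μ ν : ℝ) : Prop :=
  0 < r ∧ 0 < 1 - (1 + ε ^ 2) * r ^ 2 ∧ (μ ≠ 0 ∨ ν ≠ 0)

/-- The quadratic form under the square root of the metric. -/
noncomputable def navForm (ε r μ ν : ℝ) : ℝ := μ ^ 2 + r ^ 2 * ν ^ 2 - r ^ 2 * (r * ν + ε * μ) ^ 2

/-- The metric as a function of `(r, μ, ν)`. -/
noncomputable def navMetric (ε r μ ν : ℝ) : ℝ :=
  (√(navForm ε r μ ν) + r * μ - ε * r ^ 2 * ν) / (1 - (1 + ε ^ 2) * r ^ 2)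

/-- The derivative of the metric in `μ`. -/
noncomputable def navMetricMu (ε r μ ν : ℝ) : ℝ := (μ + r * navMetric ε r μ ν) / √(navForm ε r μ ν)

/-- The derivative of the metric in `ν`. -/
noncomputable def navMetricNu (ε r μ ν : ℝ) : ℝ :=
  r ^ 2 * (ν - ε * navMetric ε r μ ν) / √(navForm ε r μ ν)

/-- The factor `κ` for which the fibre Hessian of the metric is `κ (ν, -μ)ᵀ(ν, -μ)`. -/
noncomputable def navHess (ε r μ ν : ℝ) : ℝ := r ^ 2 / √(navForm ε r μ ν) ^ 3

/-- Half the derivative of the quadratic form in `r`. -/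
noncomputable def navFormR (ε r μ ν : ℝ) : ℝ :=
  r * ν ^ 2 - r * (r * ν + ε * μ) ^ 2 - r ^ 2 * ν * (r * ν + ε * μ)

/-- The derivative of `κ` in `r`. -/
noncomputable def navHessR (ε r μ ν : ℝ) : ℝ :=
  2 * r / √(navForm ε r μ ν) ^ 3 - 3 * r ^ 2 * navFormR ε r μ ν / √(navForm ε r μ ν) ^ 5

section Scalar

variable {ε r μ ν : ℝ}

theorem navForm_pos (h : NavDomain ε r μ ν) : 0 < navForm ε r μ ν := by
  obtain ⟨hr, hD, hy⟩ := h
  have hr2 : 0 < r ^ 2 := by positivity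
  have hc : 0 < 1 - ε ^ 2 * r ^ 2 := by linarith
  refine pos_of_mul_pos_right (a := 1 - ε ^ 2 * r ^ 2) ?_ hc.le
  have key : (1 - ε ^ 2 * r ^ 2) * navForm ε r μ ν
      = ((1 - ε ^ 2 * r ^ 2) * μ - ε * r ^ 3 * ν) ^ 2
        + r ^ 2 * (1 - (1 + ε ^ 2) * r ^ 2) * ν ^ 2 := by
    unfold navForm; ring
  rw [key]
  by_cases hν : ν = 0
  · subst hν
    have hμ : μ ≠ 0 := by simpa using hy
    have : (1 - ε ^ 2 * r ^ 2) * μ ≠ 0 := mul_ne_zero hc.ne' hμ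
    simp only [mul_zero, sub_zero, ne_eq, OfNat.ofNat_ne_zero, not_false_eq_true, zero_pow,
      add_zero]
    positivity
  · positivity

theorem sqrt_navForm_pos (h : NavDomain ε r μ ν) : 0 < √(navForm ε r μ ν) :=
  Real.sqrt_pos.2 (navForm_pos h)

theorem sq_sqrt_navForm (h : NavDomain ε r μ ν) :
    √(navForm ε r μ ν) ^ 2 = μ ^ 2 + r ^ 2 * ν ^ 2 - r ^ 2 * (r * ν + ε * μ) ^ 2 :=
  Real.sq_sqrt (navForm_pos h).le

theorem navMetric_mul (h : NavDomain ε r μ ν) :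
    navMetric ε r μ ν * (1 - (1 + ε ^ 2) * r ^ 2)
      = √(navForm ε r μ ν) + r * μ - ε * r ^ 2 * ν :=
  div_mul_cancel₀ _ h.2.1.ne'

theorem navMetric_pos (h : NavDomain ε r μ ν) : 0 < navMetric ε r μ ν := by
  have hS := sqrt_navForm_pos h
  have hS2 := sq_sqrt_navForm h
  obtain ⟨hr, hD, hy⟩ := h
  refine div_pos ?_ hD
  have hn : 0 < μ ^ 2 + r ^ 2 * ν ^ 2 := by
    rcases hy with hy | hy <;> positivity
  have hlt : (-(r * μ - ε * r ^ 2 * ν)) ^ 2 < √(navForm ε r μ ν) ^ 2 := by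
    nlinarith [mul_pos hn hD]
  linarith [lt_of_pow_lt_pow_left₀ 2 hS.le hlt]

/-- The indicatrix is the unit sphere of the Funk metric translated by the rotation field. -/
theorem navMetric_sq (h : NavDomain ε r μ ν) :
    navMetric ε r μ ν ^ 2 = (μ + r * navMetric ε r μ ν) ^ 2
      + r ^ 2 * (ν - ε * navMetric ε r μ ν) ^ 2 := by
  have hS2 := sq_sqrt_navForm h
  have hm := navMetric_mul h
  refine mul_right_cancel₀ h.2.1.ne' ?_
  linear_combination (navMetric ε r μ ν * (1 - (1 + ε ^ 2) * r ^ 2) - (r * μ - ε * r ^ 2 * ν)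
    + √(navForm ε r μ ν)) * hm + hS2

theorem navMetric_euler (h : NavDomain ε r μ ν) :
    navMetric ε r μ ν = μ * navMetricMu ε r μ ν + ν * navMetricNu ε r μ ν := by
  have hS := (sqrt_navForm_pos h).ne'
  have hq := navMetric_sq h
  have hm := navMetric_mul h
  unfold navMetricMu navMetricNu
  field_simp
  linear_combination -navMetric ε r μ ν * hm + hq

theorem hasDerivAt_sqrt_navForm_r (h : NavDomain ε r μ ν) :
    HasDerivAt (fun t => √(navForm ε t μ ν)) (navFormR ε r μ ν / √(navForm ε r μ ν)) r := by
  have hP : HasDerivAt (fun t => navForm ε t μ ν) (2 * navFormR ε r μ ν) r := by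
    have ht := hasDerivAt_id' r
    refine ((((ht.pow 2).mul_const (ν ^ 2)).const_add (μ ^ 2)).sub
      ((ht.pow 2).mul (((ht.mul_const ν).add_const (ε * μ)).pow 2))).congr_deriv ?_
    simp [navFormR]; ring
  refine (hP.sqrt (navForm_pos h).ne').congr_deriv ?_
  rw [mul_div_mul_left _ _ two_ne_zero]

theorem hasDerivAt_sqrt_navForm_mu (h : NavDomain ε r μ ν) :
    HasDerivAt (fun t => √(navForm ε r t ν))
      ((μ - r ^ 2 * ε * (r * ν + ε * μ)) / √(navForm ε r μ ν)) μ := by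
  have hP : HasDerivAt (fun t => navForm ε r t ν)
      (2 * (μ - r ^ 2 * ε * (r * ν + ε * μ))) μ := by
    have ht := hasDerivAt_id' μ
    refine (((ht.pow 2).add_const (r ^ 2 * ν ^ 2)).sub
      ((((ht.const_mul ε).const_add (r * ν)).pow 2).const_mul (r ^ 2))).congr_deriv ?_
    simp; ring
  refine (hP.sqrt (navForm_pos h).ne').congr_deriv ?_
  rw [mul_div_mul_left _ _ two_ne_zero]

theorem hasDerivAt_sqrt_navForm_nu (h : NavDomain ε r μ ν) :
    HasDerivAt (fun t => √(navForm ε r μ t))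
      ((r ^ 2 * ν - r ^ 3 * (r * ν + ε * μ)) / √(navForm ε r μ ν)) ν := by
  have hP : HasDerivAt (fun t => navForm ε r μ t)
      (2 * (r ^ 2 * ν - r ^ 3 * (r * ν + ε * μ))) ν := by
    have ht := hasDerivAt_id' ν
    refine ((((ht.pow 2).const_mul (r ^ 2)).const_add (μ ^ 2)).sub
      ((((ht.const_mul r).add_const (ε * μ)).pow 2).const_mul (r ^ 2))).congr_deriv ?_
    simp; ring
  refine (hP.sqrt (navForm_pos h).ne').congr_deriv ?_
  rw [mul_div_mul_left _ _ two_ne_zero]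

theorem hasDerivAt_navMetric_mu (h : NavDomain ε r μ ν) :
    HasDerivAt (fun t => navMetric ε r t ν) (navMetricMu ε r μ ν) μ := by
  refine ((((hasDerivAt_sqrt_navForm_mu h).add ((hasDerivAt_id' μ).const_mul r)).sub_const
    (ε * r ^ 2 * ν)).div_const _).congr_deriv ?_
  have hS := (sqrt_navForm_pos h).ne'
  have hm := navMetric_mul h
  have hD := h.2.1.ne'
  unfold navMetricMu
  rw [div_eq_iff hD, div_add' _ _ _ hS, div_mul_eq_mul_div]
  congr 1
  linear_combination -r * hm

theorem hasDerivAt_navMetric_nu (h : NavDomain ε r μ ν) :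
    HasDerivAt (fun t => navMetric ε r μ t) (navMetricNu ε r μ ν) ν := by
  refine ((((hasDerivAt_sqrt_navForm_nu h).add_const (r * μ)).sub
    ((hasDerivAt_id' ν).const_mul (ε * r ^ 2))).div_const _).congr_deriv ?_
  have hS := (sqrt_navForm_pos h).ne'
  have hm := navMetric_mul h
  have hD := h.2.1.ne'
  unfold navMetricNu
  rw [div_eq_iff hD, div_sub' hS, div_mul_eq_mul_div]
  congr 1
  linear_combination ε * r ^ 2 * hm

theorem hasDerivAt_navMetric_r (h : NavDomain ε r μ ν) :
    HasDerivAt (fun t => navMetric ε t μ ν)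
      (navMetric ε r μ ν * navMetricMu ε r μ ν
        + (ν - ε * navMetric ε r μ ν) / r * navMetricNu ε r μ ν) r := by
  have ht := hasDerivAt_id' r
  refine ((((hasDerivAt_sqrt_navForm_r h).add (ht.mul_const μ)).sub
    (((ht.pow 2).const_mul ε).mul_const ν)).div
    (((ht.pow 2).const_mul (1 + ε ^ 2)).const_sub 1) h.2.1.ne').congr_deriv ?_
  have hS := (sqrt_navForm_pos h).ne'
  have hS2 := sq_sqrt_navForm h
  have hm := navMetric_mul h
  have hq := navMetric_sq h
  have hD := h.2.1.ne'
  have hr := h.1.ne'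
  unfold navMetricMu navMetricNu navFormR
  simp only [Pi.add_apply, Pi.sub_apply, Pi.pow_apply]
  generalize navMetric ε r μ ν = f at *
  generalize √(navForm ε r μ ν) = S at *
  have hS' : S = f * (1 - (1 + ε ^ 2) * r ^ 2) - r * μ + ε * r ^ 2 * ν := by linarith
  rw [← hm]
  field_simp
  grind

theorem hasDerivAt_navMetricMu_mu (h : NavDomain ε r μ ν) :
    HasDerivAt (fun t => navMetricMu ε r t ν) (ν ^ 2 * navHess ε r μ ν) μ := by
  refine ((((hasDerivAt_id' μ).add ((hasDerivAt_navMetric_mu h).const_mul r)).div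
    (hasDerivAt_sqrt_navForm_mu h) (sqrt_navForm_pos h).ne')).congr_deriv ?_
  have hS := (sqrt_navForm_pos h).ne'
  have hS2 := sq_sqrt_navForm h
  have hm := navMetric_mul h
  have hq := navMetric_sq h
  unfold navMetricMu navHess
  simp only [Pi.add_apply]
  generalize navMetric ε r μ ν = f at *
  generalize √(navForm ε r μ ν) = S at *
  field_simp
  grind

theorem hasDerivAt_navMetricMu_nu (h : NavDomain ε r μ ν) :
    HasDerivAt (fun t => navMetricMu ε r μ t) (-(μ * ν) * navHess ε r μ ν) ν := by
  refine ((((hasDerivAt_navMetric_nu h).const_mul r).const_add μ).div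
    (hasDerivAt_sqrt_navForm_nu h) (sqrt_navForm_pos h).ne').congr_deriv ?_
  have hS := (sqrt_navForm_pos h).ne'
  have hS2 := sq_sqrt_navForm h
  have hm := navMetric_mul h
  have hq := navMetric_sq h
  unfold navMetricNu navHess
  generalize navMetric ε r μ ν = f at *
  generalize √(navForm ε r μ ν) = S at *
  field_simp
  grind

theorem hasDerivAt_navMetricNu_mu (h : NavDomain ε r μ ν) :
    HasDerivAt (fun t => navMetricNu ε r t ν) (-(μ * ν) * navHess ε r μ ν) μ := by
  refine ((((hasDerivAt_navMetric_mu h).const_mul ε).const_sub ν).const_mul (r ^ 2) |>.div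
    (hasDerivAt_sqrt_navForm_mu h) (sqrt_navForm_pos h).ne').congr_deriv ?_
  have hS := (sqrt_navForm_pos h).ne'
  have hS2 := sq_sqrt_navForm h
  have hm := navMetric_mul h
  have hq := navMetric_sq h
  unfold navMetricMu navHess
  generalize navMetric ε r μ ν = f at *
  generalize √(navForm ε r μ ν) = S at *
  field_simp
  grind

theorem hasDerivAt_navMetricNu_nu (h : NavDomain ε r μ ν) :
    HasDerivAt (fun t => navMetricNu ε r μ t) (μ ^ 2 * navHess ε r μ ν) ν := by
  refine (((hasDerivAt_id' ν).sub ((hasDerivAt_navMetric_nu h).const_mul ε)).const_mul (r ^ 2)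
    |>.div (hasDerivAt_sqrt_navForm_nu h) (sqrt_navForm_pos h).ne').congr_deriv ?_
  have hS := (sqrt_navForm_pos h).ne'
  have hS2 := sq_sqrt_navForm h
  have hm := navMetric_mul h
  have hq := navMetric_sq h
  unfold navMetricNu navHess
  simp only [Pi.sub_apply]
  generalize navMetric ε r μ ν = f at *
  generalize √(navForm ε r μ ν) = S at *
  field_simp
  grind

theorem hasDerivAt_navMetricMu_r (h : NavDomain ε r μ ν) :
    HasDerivAt (fun t => navMetricMu ε t μ ν)
      (navMetricMu ε r μ ν ^ 2 + navMetric ε r μ ν * (ν ^ 2 * navHess ε r μ ν)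
        - ε * navMetricMu ε r μ ν * navMetricNu ε r μ ν / r
        + (ν - ε * navMetric ε r μ ν) / r * (-(μ * ν) * navHess ε r μ ν)) r := by
  refine ((((hasDerivAt_id' r).mul (hasDerivAt_navMetric_r h)).const_add μ).div
    (hasDerivAt_sqrt_navForm_r h) (sqrt_navForm_pos h).ne').congr_deriv ?_
  have hS := (sqrt_navForm_pos h).ne'
  have hS2 := sq_sqrt_navForm h
  have hm := navMetric_mul h
  have hq := navMetric_sq h
  have hr := h.1.ne'
  unfold navMetricMu navMetricNu navHess navFormR
  simp only [Pi.mul_apply]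
  generalize navMetric ε r μ ν = f at *
  generalize √(navForm ε r μ ν) = S at *
  field_simp
  grind

theorem hasDerivAt_navMetricNu_r (h : NavDomain ε r μ ν) :
    HasDerivAt (fun t => navMetricNu ε t μ ν)
      (navMetricMu ε r μ ν * navMetricNu ε r μ ν
        + navMetric ε r μ ν * (-(μ * ν) * navHess ε r μ ν)
        + (1 - ε * navMetricNu ε r μ ν) * navMetricNu ε r μ ν / r
        + (ν - ε * navMetric ε r μ ν) / r * (μ ^ 2 * navHess ε r μ ν)) r := by
  refine ((((hasDerivAt_id' r).pow 2).mul
    (((hasDerivAt_navMetric_r h).const_mul ε).const_sub ν)).div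
    (hasDerivAt_sqrt_navForm_r h) (sqrt_navForm_pos h).ne').congr_deriv ?_
  have hS := (sqrt_navForm_pos h).ne'
  have hS2 := sq_sqrt_navForm h
  have hm := navMetric_mul h
  have hq := navMetric_sq h
  have hr := h.1.ne'
  unfold navMetricMu navMetricNu navHess navFormR
  simp only [Pi.mul_apply, Pi.pow_apply]
  generalize navMetric ε r μ ν = f at *
  generalize √(navForm ε r μ ν) = S at *
  field_simp
  grind

theorem hasDerivAt_navHess_r (h : NavDomain ε r μ ν) :
    HasDerivAt (fun t => navHess ε t μ ν) (navHessR ε r μ ν) r := by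
  refine (((hasDerivAt_id' r).pow 2).div ((hasDerivAt_sqrt_navForm_r h).pow 3)
    (pow_pos (sqrt_navForm_pos h) 3).ne').congr_deriv ?_
  have hS := (sqrt_navForm_pos h).ne'
  unfold navHessR
  simp only [Pi.pow_apply]
  generalize √(navForm ε r μ ν) = S at *
  field_simp
  ring

/-- The first spray coefficient as a function of `(r, μ, ν)`. -/
noncomputable def navSpray₁ (ε r μ ν : ℝ) : ℝ :=
  (μ * navMetric ε r μ ν - r * (ν - ε * navMetric ε r μ ν) ^ 2) / 2

/-- The second spray coefficient as a function of `(r, μ, ν)`. -/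
noncomputable def navSpray₂ (ε r μ ν : ℝ) : ℝ :=
  (ν - ε * navMetric ε r μ ν) * (μ / r + navMetric ε r μ ν / 2)

/-- The `μ`-derivative of the first spray coefficient. -/
noncomputable def navSpray₁Mu (ε r μ ν : ℝ) : ℝ :=
  (navMetric ε r μ ν + μ * navMetricMu ε r μ ν) / 2
    + r * ε * (ν - ε * navMetric ε r μ ν) * navMetricMu ε r μ ν

/-- The `ν`-derivative of the first spray coefficient. -/
noncomputable def navSpray₁Nu (ε r μ ν : ℝ) : ℝ :=
  μ * navMetricNu ε r μ ν / 2
    - r * (ν - ε * navMetric ε r μ ν) * (1 - ε * navMetricNu ε r μ ν)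

/-- The `μ`-derivative of the second spray coefficient. -/
noncomputable def navSpray₂Mu (ε r μ ν : ℝ) : ℝ :=
  -(ε * navMetricMu ε r μ ν) * (μ / r + navMetric ε r μ ν / 2)
    + (ν - ε * navMetric ε r μ ν) * (1 / r + navMetricMu ε r μ ν / 2)

/-- The `ν`-derivative of the second spray coefficient. -/
noncomputable def navSpray₂Nu (ε r μ ν : ℝ) : ℝ :=
  (1 - ε * navMetricNu ε r μ ν) * (μ / r + navMetric ε r μ ν / 2)
    + (ν - ε * navMetric ε r μ ν) * (navMetricNu ε r μ ν / 2)

theorem hasDerivAt_navSpray₁_mu (h : NavDomain ε r μ ν) :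
    HasDerivAt (fun t => navSpray₁ ε r t ν) (navSpray₁Mu ε r μ ν) μ := by
  have hf := hasDerivAt_navMetric_mu h
  refine ((((hasDerivAt_id' μ).mul hf).sub
    ((((hf.const_mul ε).const_sub ν).pow 2).const_mul r)).div_const 2).congr_deriv ?_
  simp [navSpray₁Mu]; ring

theorem hasDerivAt_navSpray₁_nu (h : NavDomain ε r μ ν) :
    HasDerivAt (fun t => navSpray₁ ε r μ t) (navSpray₁Nu ε r μ ν) ν := by
  have hf := hasDerivAt_navMetric_nu h
  refine (((hf.const_mul μ).sub
    ((((hasDerivAt_id' ν).sub (hf.const_mul ε)).pow 2).const_mul r)).div_const 2).congr_deriv ?_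
  simp [navSpray₁Nu]; ring

theorem hasDerivAt_navSpray₂_mu (h : NavDomain ε r μ ν) :
    HasDerivAt (fun t => navSpray₂ ε r t ν) (navSpray₂Mu ε r μ ν) μ := by
  have hf := hasDerivAt_navMetric_mu h
  refine (((hf.const_mul ε).const_sub ν).mul
    (((hasDerivAt_id' μ).div_const r).add (hf.div_const 2))).congr_deriv ?_
  simp [navSpray₂Mu]

theorem hasDerivAt_navSpray₂_nu (h : NavDomain ε r μ ν) :
    HasDerivAt (fun t => navSpray₂ ε r μ t) (navSpray₂Nu ε r μ ν) ν := by
  have hf := hasDerivAt_navMetric_nu h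
  refine (((hasDerivAt_id' ν).sub (hf.const_mul ε)).mul
    ((hf.div_const 2).const_add (μ / r))).congr_deriv ?_
  simp [navSpray₂Nu]

end Scalar

section Lift

variable {ε : ℝ} {x y : Fin 2 → ℝ} {g : (Fin 2 → ℝ) → (Fin 2 → ℝ) → ℝ}
  {p p' : ℝ → ℝ → ℝ → ℝ}

/-- `g` is given by the function `p` of `(r, μ, ν)` on the navigation domain. -/
def NavEq (ε : ℝ) (g : (Fin 2 → ℝ) → (Fin 2 → ℝ) → ℝ) (p : ℝ → ℝ → ℝ → ℝ) : Prop :=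
  ∀ x y : Fin 2 → ℝ, NavDomain ε (x 0) (y 0) (y 1) → g x y = p (x 0) (y 0) (y 1)

theorem isOpen_navDomain (ε : ℝ) :
    IsOpen {z : (Fin 2 → ℝ) × (Fin 2 → ℝ) | NavDomain ε (z.1 0) (z.2 0) (z.2 1)} := by
  have h0 : Continuous fun z : (Fin 2 → ℝ) × (Fin 2 → ℝ) => z.1 0 := by fun_prop
  have h1 : Continuous fun z : (Fin 2 → ℝ) × (Fin 2 → ℝ) => z.2 0 := by fun_prop
  have h2 : Continuous fun z : (Fin 2 → ℝ) × (Fin 2 → ℝ) => z.2 1 := by fun_prop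
  exact (isOpen_lt continuous_const h0).inter
    ((isOpen_lt continuous_const (continuous_const.sub (continuous_const.mul (h0.pow 2)))).inter
      ((isOpen_ne_fun h1 continuous_const).union (isOpen_ne_fun h2 continuous_const)))

theorem NavEq.eventually_base (hg : NavEq ε g p) (h : NavDomain ε (x 0) (y 0) (y 1))
    (i : Fin 2) : (fun t => g (Function.update x i t) y)
      =ᶠ[nhds (x i)] fun t => p (Function.update x i t 0) (y 0) (y 1) := by
  have hc : Continuous fun t : ℝ => (Function.update x i t, y) :=
    Continuous.prodMk (Continuous.update continuous_const i continuous_id) continuous_const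
  filter_upwards [((isOpen_navDomain ε).preimage hc).mem_nhds (by simpa using h)] with t ht
  exact hg _ _ ht

theorem NavEq.eventually_fibre (hg : NavEq ε g p) (h : NavDomain ε (x 0) (y 0) (y 1))
    (i : Fin 2) : (fun t => g x (Function.update y i t))
      =ᶠ[nhds (y i)] fun t => p (x 0) (Function.update y i t 0) (Function.update y i t 1) := by
  have hc : Continuous fun t : ℝ => (x, Function.update y i t) :=
    Continuous.prodMk continuous_const (Continuous.update continuous_const i continuous_id)
  filter_upwards [((isOpen_navDomain ε).preimage hc).mem_nhds (by simpa using h)] with t ht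
  exact hg _ _ ht

theorem NavEq.pdx_zero (hg : NavEq ε g p)
    (hp : ∀ r μ ν, NavDomain ε r μ ν → HasDerivAt (fun t => p t μ ν) (p' r μ ν) r) :
    NavEq ε (pdx 0 g) p' := by
  intro x y h
  rw [pdx, (hg.eventually_base h 0).deriv_eq]
  simpa using (hp _ _ _ h).deriv

theorem NavEq.pdx_one (hg : NavEq ε g p) : NavEq ε (pdx 1 g) fun _ _ _ => 0 := by
  intro x y h
  rw [pdx, (hg.eventually_base h 1).deriv_eq]
  simp

theorem NavEq.pdy_zero (hg : NavEq ε g p)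
    (hp : ∀ r μ ν, NavDomain ε r μ ν → HasDerivAt (fun t => p r t ν) (p' r μ ν) μ) :
    NavEq ε (pdy 0 g) p' := by
  intro x y h
  rw [pdy, (hg.eventually_fibre h 0).deriv_eq]
  simpa using (hp _ _ _ h).deriv

theorem NavEq.pdy_one (hg : NavEq ε g p)
    (hp : ∀ r μ ν, NavDomain ε r μ ν → HasDerivAt (fun t => p r μ t) (p' r μ ν) ν) :
    NavEq ε (pdy 1 g) p' := by
  intro x y h
  rw [pdy, (hg.eventually_fibre h 1).deriv_eq]
  simpa using (hp _ _ _ h).deriv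

end Lift

section Tensor

variable {ε : ℝ} {F : (Fin 2 → ℝ) → (Fin 2 → ℝ) → ℝ}

theorem NavEq.pdy_zero_sq (hF : NavEq ε F (navMetric ε)) :
    NavEq ε (pdy 0 fun x y => F x y ^ 2)
      fun r μ ν => 2 * navMetric ε r μ ν * navMetricMu ε r μ ν := by
  have h2 : NavEq ε (fun x y => F x y ^ 2) fun r μ ν => navMetric ε r μ ν ^ 2 :=
    fun x y h => congrArg (· ^ 2) (hF x y h)
  refine h2.pdy_zero fun r μ ν h => ?_
  exact ((hasDerivAt_navMetric_mu h).pow 2).congr_deriv (by simp)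

theorem NavEq.pdy_one_sq (hF : NavEq ε F (navMetric ε)) :
    NavEq ε (pdy 1 fun x y => F x y ^ 2)
      fun r μ ν => 2 * navMetric ε r μ ν * navMetricNu ε r μ ν := by
  have h2 : NavEq ε (fun x y => F x y ^ 2) fun r μ ν => navMetric ε r μ ν ^ 2 :=
    fun x y h => congrArg (· ^ 2) (hF x y h)
  refine h2.pdy_one fun r μ ν h => ?_
  exact ((hasDerivAt_navMetric_nu h).pow 2).congr_deriv (by simp)

theorem NavEq.fundTensor_zero_zero (hF : NavEq ε F (navMetric ε)) :
    NavEq ε (fundTensor F 0 0) fun r μ ν =>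
      navMetricMu ε r μ ν ^ 2 + navMetric ε r μ ν * (ν ^ 2 * navHess ε r μ ν) := by
  intro x y h
  rw [fundTensor, hF.pdy_zero_sq.pdy_zero (fun r μ ν h =>
    ((hasDerivAt_navMetric_mu h).const_mul 2).mul (hasDerivAt_navMetricMu_mu h)) x y h]
  ring

theorem NavEq.fundTensor_zero_one (hF : NavEq ε F (navMetric ε)) :
    NavEq ε (fundTensor F 0 1) fun r μ ν =>
      navMetricMu ε r μ ν * navMetricNu ε r μ ν
        + navMetric ε r μ ν * (-(μ * ν) * navHess ε r μ ν) := by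
  intro x y h
  rw [fundTensor, hF.pdy_one_sq.pdy_zero (fun r μ ν h =>
    ((hasDerivAt_navMetric_mu h).const_mul 2).mul (hasDerivAt_navMetricNu_mu h)) x y h]
  ring

theorem NavEq.fundTensor_one_zero (hF : NavEq ε F (navMetric ε)) :
    NavEq ε (fundTensor F 1 0) fun r μ ν =>
      navMetricMu ε r μ ν * navMetricNu ε r μ ν
        + navMetric ε r μ ν * (-(μ * ν) * navHess ε r μ ν) := by
  intro x y h
  rw [fundTensor, hF.pdy_zero_sq.pdy_one (fun r μ ν h =>
    ((hasDerivAt_navMetric_nu h).const_mul 2).mul (hasDerivAt_navMetricMu_nu h)) x y h]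
  ring

theorem NavEq.fundTensor_one_one (hF : NavEq ε F (navMetric ε)) :
    NavEq ε (fundTensor F 1 1) fun r μ ν =>
      navMetricNu ε r μ ν ^ 2 + navMetric ε r μ ν * (μ ^ 2 * navHess ε r μ ν) := by
  intro x y h
  rw [fundTensor, hF.pdy_one_sq.pdy_one (fun r μ ν h =>
    ((hasDerivAt_navMetric_nu h).const_mul 2).mul (hasDerivAt_navMetricNu_nu h)) x y h]
  ring

theorem navHess_pos {r μ ν : ℝ} (h : NavDomain ε r μ ν) : 0 < navHess ε r μ ν :=
  div_pos (pow_pos h.1 2) (pow_pos (sqrt_navForm_pos h) 3)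

theorem NavEq.fundMatrix_det (hF : NavEq ε F (navMetric ε)) {x y : Fin 2 → ℝ}
    (h : NavDomain ε (x 0) (y 0) (y 1)) :
    (fundMatrix F x y).det
      = navHess ε (x 0) (y 0) (y 1) * navMetric ε (x 0) (y 0) (y 1) ^ 3 := by
  have he := navMetric_euler h
  simp only [fundMatrix, Matrix.det_fin_two, Matrix.of_apply,
    hF.fundTensor_zero_zero x y h, hF.fundTensor_zero_one x y h,
    hF.fundTensor_one_zero x y h, hF.fundTensor_one_one x y h]
  linear_combination (-(navHess ε (x 0) (y 0) (y 1)) * navMetric ε (x 0) (y 0) (y 1) *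
    (navMetric ε (x 0) (y 0) (y 1) + y 0 * navMetricMu ε (x 0) (y 0) (y 1)
      + y 1 * navMetricNu ε (x 0) (y 0) (y 1))) * he

theorem NavEq.fundMatrix_posDef (hF : NavEq ε F (navMetric ε)) {x y : Fin 2 → ℝ}
    (h : NavDomain ε (x 0) (y 0) (y 1)) : (fundMatrix F x y).PosDef := by
  have he := navMetric_euler h
  have hf := navMetric_pos h
  have hk := mul_pos hf (navHess_pos h)
  refine Matrix.PosDef.of_dotProduct_mulVec_pos ?_ fun v hv => ?_
  · ext i j
    fin_cases i <;> fin_cases j <;>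
      simp [fundMatrix, hF.fundTensor_zero_one x y h, hF.fundTensor_one_zero x y h]
  · have key : star v ⬝ᵥ (fundMatrix F x y).mulVec v
        = (navMetricMu ε (x 0) (y 0) (y 1) * v 0 + navMetricNu ε (x 0) (y 0) (y 1) * v 1) ^ 2
          + navMetric ε (x 0) (y 0) (y 1) * navHess ε (x 0) (y 0) (y 1)
            * (y 1 * v 0 - y 0 * v 1) ^ 2 := by
      simp [fundMatrix, Matrix.mulVec, dotProduct, Fin.sum_univ_two,
        hF.fundTensor_zero_zero x y h, hF.fundTensor_zero_one x y h,
        hF.fundTensor_one_zero x y h, hF.fundTensor_one_one x y h]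
      ring
    rw [key]
    refine lt_of_le_of_ne (by positivity) fun h0 => hv ?_
    have hs : (navMetricMu ε (x 0) (y 0) (y 1) * v 0
        + navMetricNu ε (x 0) (y 0) (y 1) * v 1) ^ 2 = 0 :=
      le_antisymm (by nlinarith [mul_nonneg hk.le (sq_nonneg (y 1 * v 0 - y 0 * v 1))])
        (sq_nonneg _)
    have ht : navMetric ε (x 0) (y 0) (y 1) * navHess ε (x 0) (y 0) (y 1)
        * (y 1 * v 0 - y 0 * v 1) ^ 2 = 0 := by linarith
    have hs' := pow_eq_zero_iff two_ne_zero |>.1 hs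
    have ht' := pow_eq_zero_iff two_ne_zero |>.1 ((mul_eq_zero.1 ht).resolve_left hk.ne')
    ext i
    refine (mul_eq_zero.1 (?_ : navMetric ε (x 0) (y 0) (y 1) * v i = 0)).resolve_left hf.ne'
    fin_cases i
    · simp only [Fin.zero_eta, Fin.isValue]
      linear_combination v 0 * he + y 0 * hs' + navMetricNu ε (x 0) (y 0) (y 1) * ht'
    · simp only [Fin.mk_one, Fin.isValue]
      linear_combination v 1 * he + y 1 * hs' - navMetricMu ε (x 0) (y 0) (y 1) * ht'

theorem NavEq.sprayCoeff_eq (hF : NavEq ε F (navMetric ε)) {x y : Fin 2 → ℝ}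
    (h : NavDomain ε (x 0) (y 0) (y 1)) :
    (fun i => sprayCoeff F i x y)
      = ![navSpray₁ ε (x 0) (y 0) (y 1), navSpray₂ ε (x 0) (y 0) (y 1)] := by
  have h00 := hF.fundTensor_zero_zero.pdx_zero (fun r μ ν h =>
    ((hasDerivAt_navMetricMu_r h).pow 2).add
      ((hasDerivAt_navMetric_r h).mul ((hasDerivAt_navHess_r h).const_mul (ν ^ 2)))) x y h
  have h01 := hF.fundTensor_zero_one.pdx_zero (fun r μ ν h =>
    ((hasDerivAt_navMetricMu_r h).mul (hasDerivAt_navMetricNu_r h)).add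
      ((hasDerivAt_navMetric_r h).mul ((hasDerivAt_navHess_r h).const_mul (-(μ * ν))))) x y h
  have h10 := hF.fundTensor_one_zero.pdx_zero (fun r μ ν h =>
    ((hasDerivAt_navMetricMu_r h).mul (hasDerivAt_navMetricNu_r h)).add
      ((hasDerivAt_navMetric_r h).mul ((hasDerivAt_navHess_r h).const_mul (-(μ * ν))))) x y h
  have h11 := hF.fundTensor_one_one.pdx_zero (fun r μ ν h =>
    ((hasDerivAt_navMetricNu_r h).pow 2).add
      ((hasDerivAt_navMetric_r h).mul ((hasDerivAt_navHess_r h).const_mul (μ ^ 2)))) x y h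
  have hdet : IsUnit (fundMatrix F x y).det := by
    rw [hF.fundMatrix_det h]
    exact (mul_pos (navHess_pos h) (pow_pos (navMetric_pos h) 3)).ne'.isUnit
  have he := navMetric_euler h
  have hq := navMetric_sq h
  have hm := navMetric_mul h
  have hS := (sqrt_navForm_pos h).ne'
  have hr := h.1.ne'
  set b : Fin 2 → ℝ := fun k => ∑ p, ∑ q,
    (2 * pdx q (fundTensor F p k) x y - pdx k (fundTensor F p q) x y) * y p * y q with hb
  have hspray : (fun i => sprayCoeff F i x y) = (1 / 4 : ℝ) • (fundMatrix F x y)⁻¹.mulVec b := by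
    ext i
    rfl
  have hmul (v : Fin 2 → ℝ) (k : Fin 2) : (fundMatrix F x y).mulVec v k
      = fundTensor F k 0 x y * v 0 + fundTensor F k 1 x y * v 1 := by
    simp only [Matrix.mulVec, dotProduct, Fin.sum_univ_two, fundMatrix, Matrix.of_apply]
  have hsys : b = (4 : ℝ) • (fundMatrix F x y).mulVec
      ![navSpray₁ ε (x 0) (y 0) (y 1), navSpray₂ ε (x 0) (y 0) (y 1)] := by
    ext k
    rw [Pi.smul_apply, hmul, hb]
    fin_cases k <;>
    · simp only [Fin.zero_eta, Fin.mk_one, Fin.isValue, Fin.sum_univ_two, h00, h01, h10, h11,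
        hF.fundTensor_zero_zero.pdx_one x y h, hF.fundTensor_zero_one.pdx_one x y h,
        hF.fundTensor_one_zero.pdx_one x y h, hF.fundTensor_one_one.pdx_one x y h,
        hF.fundTensor_zero_zero x y h, hF.fundTensor_zero_one x y h,
        hF.fundTensor_one_zero x y h, hF.fundTensor_one_one x y h, navSpray₁, navSpray₂,
        Matrix.cons_val_zero, Matrix.cons_val_one, smul_eq_mul]
      unfold navMetricMu navMetricNu navHess
      generalize navHessR ε (x 0) (y 0) (y 1) = k at *
      generalize navMetric ε (x 0) (y 0) (y 1) = f at *
      generalize √(navForm ε (x 0) (y 0) (y 1)) = S at *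
      clear h00 h01 h10 h11 hb hspray hmul hdet h hF he
      clear b
      generalize x 0 = r at *
      generalize y 0 = μ at *
      generalize y 1 = ν at *
      have hS2 : S = f * (1 - (1 + ε ^ 2) * r ^ 2) - r * μ + ε * r ^ 2 * ν := by linarith
      push_cast
      field_simp
      obtain ⟨w, rfl⟩ : ∃ w, ν = w + ε * f := ⟨ν - ε * f, by ring⟩
      obtain ⟨a, rfl⟩ : ∃ a, μ = a - r * f := ⟨μ + r * f, by ring⟩
      have hS3 : S = f - r * a + ε * r ^ 2 * w := by rw [hS2]; ring
      have hf : f ^ 2 = a ^ 2 + r ^ 2 * w ^ 2 := by linear_combination hq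
      clear hS2 hq hm hS
      ring_nf at hS3 hf ⊢
      subst hS3
      grind
  rw [hspray, hsys, Matrix.mulVec_smul, smul_smul, Matrix.mulVec_mulVec,
    Matrix.nonsing_inv_mul _ hdet, Matrix.one_mulVec]
  norm_num

theorem NavEq.sprayCoeff_zero (hF : NavEq ε F (navMetric ε)) :
    NavEq ε (sprayCoeff F 0) (navSpray₁ ε) :=
  fun _ _ h => congrFun (hF.sprayCoeff_eq h) 0

theorem NavEq.sprayCoeff_one (hF : NavEq ε F (navMetric ε)) :
    NavEq ε (sprayCoeff F 1) (navSpray₂ ε) :=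
  fun _ _ h => congrFun (hF.sprayCoeff_eq h) 1

/-- The Riemann curvature coefficients of the navigation metric. -/
theorem NavEq.riemCoeff_eq (hF : NavEq ε F (navMetric ε)) {x y : Fin 2 → ℝ}
    (h : NavDomain ε (x 0) (y 0) (y 1)) (i k : Fin 2) :
    riemCoeff F i k x y = -(1 / 4) * (F x y ^ 2 * (if i = k then 1 else 0)
      - F x y * pdy k F x y * y i) := by
  have hG0 := hF.sprayCoeff_zero
  have hG1 := hF.sprayCoeff_one
  have hG00 := hG0.pdy_zero fun _ _ _ h => hasDerivAt_navSpray₁_mu h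
  have hG01 := hG0.pdy_one fun _ _ _ h => hasDerivAt_navSpray₁_nu h
  have hG10 := hG1.pdy_zero fun _ _ _ h => hasDerivAt_navSpray₂_mu h
  have hG11 := hG1.pdy_one fun _ _ _ h => hasDerivAt_navSpray₂_nu h
  have hF0 := hF.pdy_zero (fun _ _ _ h => hasDerivAt_navMetric_mu h) x y h
  have hF1 := hF.pdy_one (fun _ _ _ h => hasDerivAt_navMetric_nu h) x y h
  have hX0 := hG0.pdx_zero (fun r μ ν h =>
    (((hasDerivAt_navMetric_r h).const_mul μ).sub ((hasDerivAt_id' r).mul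
      ((((hasDerivAt_navMetric_r h).const_mul ε).const_sub ν).pow 2))).div_const 2) x y h
  have hX1 := hG1.pdx_zero (fun r μ ν h =>
    (((hasDerivAt_navMetric_r h).const_mul ε).const_sub ν).mul
      (((hasDerivAt_inv h.1.ne').const_mul μ).add
        ((hasDerivAt_navMetric_r h).div_const 2))) x y h
  have hX00 := hG00.pdx_zero (fun r μ ν h =>
    (((hasDerivAt_navMetric_r h).add ((hasDerivAt_navMetricMu_r h).const_mul μ)).div_const 2).add
      ((((hasDerivAt_id' r).mul_const ε).mul
        (((hasDerivAt_navMetric_r h).const_mul ε).const_sub ν)).mul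
          (hasDerivAt_navMetricMu_r h))) x y h
  have hX01 := hG01.pdx_zero (fun r μ ν h =>
    (((hasDerivAt_navMetricNu_r h).const_mul μ).div_const 2).sub
      (((hasDerivAt_id' r).mul (((hasDerivAt_navMetric_r h).const_mul ε).const_sub ν)).mul
        (((hasDerivAt_navMetricNu_r h).const_mul ε).const_sub 1))) x y h
  have hX10 := hG10.pdx_zero (fun r μ ν h =>
    (((hasDerivAt_navMetricMu_r h).const_mul ε).neg.mul
      (((hasDerivAt_inv h.1.ne').const_mul μ).add
        ((hasDerivAt_navMetric_r h).div_const 2))).add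
      ((((hasDerivAt_navMetric_r h).const_mul ε).const_sub ν).mul
        (((hasDerivAt_inv h.1.ne').const_mul 1).add
          ((hasDerivAt_navMetricMu_r h).div_const 2)))) x y h
  have hX11 := hG11.pdx_zero (fun r μ ν h =>
    ((((hasDerivAt_navMetricNu_r h).const_mul ε).const_sub 1).mul
      (((hasDerivAt_inv h.1.ne').const_mul μ).add
        ((hasDerivAt_navMetric_r h).div_const 2))).add
      ((((hasDerivAt_navMetric_r h).const_mul ε).const_sub ν).mul
        ((hasDerivAt_navMetricNu_r h).div_const 2))) x y h
  have hY000 := hG00.pdy_zero (fun r μ ν h =>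
    (((hasDerivAt_navMetric_mu h).add
      ((hasDerivAt_id' μ).mul (hasDerivAt_navMetricMu_mu h))).div_const 2).add
      (((((hasDerivAt_navMetric_mu h).const_mul ε).const_sub ν).const_mul (r * ε)).mul
        (hasDerivAt_navMetricMu_mu h))) x y h
  have hY001 := hG00.pdy_one (fun r μ ν h =>
    (((hasDerivAt_navMetric_nu h).add
      ((hasDerivAt_navMetricMu_nu h).const_mul μ)).div_const 2).add
      ((((hasDerivAt_id' ν).sub ((hasDerivAt_navMetric_nu h).const_mul ε)).const_mul (r * ε)).mul
        (hasDerivAt_navMetricMu_nu h))) x y h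
  have hY010 := hG01.pdy_zero (fun r μ ν h =>
    (((hasDerivAt_id' μ).mul (hasDerivAt_navMetricNu_mu h)).div_const 2).sub
      (((((hasDerivAt_navMetric_mu h).const_mul ε).const_sub ν).const_mul r).mul
        (((hasDerivAt_navMetricNu_mu h).const_mul ε).const_sub 1))) x y h
  have hY011 := hG01.pdy_one (fun r μ ν h =>
    (((hasDerivAt_navMetricNu_nu h).const_mul μ).div_const 2).sub
      ((((hasDerivAt_id' ν).sub ((hasDerivAt_navMetric_nu h).const_mul ε)).const_mul r).mul
        (((hasDerivAt_navMetricNu_nu h).const_mul ε).const_sub 1))) x y h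
  have hY100 := hG10.pdy_zero (fun r μ ν h =>
    (((hasDerivAt_navMetricMu_mu h).const_mul ε).neg.mul
      (((hasDerivAt_id' μ).div_const r).add ((hasDerivAt_navMetric_mu h).div_const 2))).add
      ((((hasDerivAt_navMetric_mu h).const_mul ε).const_sub ν).mul
        (((hasDerivAt_navMetricMu_mu h).div_const 2).const_add (1 / r)))) x y h
  have hY101 := hG10.pdy_one (fun r μ ν h =>
    (((hasDerivAt_navMetricMu_nu h).const_mul ε).neg.mul
      (((hasDerivAt_navMetric_nu h).div_const 2).const_add (μ / r))).add
      (((hasDerivAt_id' ν).sub ((hasDerivAt_navMetric_nu h).const_mul ε)).mul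
        (((hasDerivAt_navMetricMu_nu h).div_const 2).const_add (1 / r)))) x y h
  have hY110 := hG11.pdy_zero (fun r μ ν h =>
    ((((hasDerivAt_navMetricNu_mu h).const_mul ε).const_sub 1).mul
      (((hasDerivAt_id' μ).div_const r).add ((hasDerivAt_navMetric_mu h).div_const 2))).add
      ((((hasDerivAt_navMetric_mu h).const_mul ε).const_sub ν).mul
        ((hasDerivAt_navMetricNu_mu h).div_const 2))) x y h
  have hY111 := hG11.pdy_one (fun r μ ν h =>
    ((((hasDerivAt_navMetricNu_nu h).const_mul ε).const_sub 1).mul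
      (((hasDerivAt_navMetric_nu h).div_const 2).const_add (μ / r))).add
      (((hasDerivAt_id' ν).sub ((hasDerivAt_navMetric_nu h).const_mul ε)).mul
        ((hasDerivAt_navMetricNu_nu h).div_const 2))) x y h
  have hq := navMetric_sq h
  have hm := navMetric_mul h
  have hS := (sqrt_navForm_pos h).ne'
  have hr := h.1.ne'
  have hFxy := hF x y h
  fin_cases i <;> fin_cases k <;>
  · simp only [Fin.zero_eta, Fin.mk_one, Fin.isValue, riemCoeff, Fin.sum_univ_two, hFxy, hF0, hF1,
      hX0, hX1, hX00, hX01, hX10, hX11, hY000, hY001, hY010, hY011, hY100, hY101, hY110, hY111,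
      hG0.pdx_one x y h, hG1.pdx_one x y h, hG00.pdx_one x y h, hG01.pdx_one x y h,
      hG10.pdx_one x y h, hG11.pdx_one x y h, hG0 x y h, hG1 x y h, hG00 x y h, hG01 x y h,
      hG10 x y h, hG11 x y h, navSpray₁, navSpray₂, navSpray₁Mu, navSpray₁Nu, navSpray₂Mu,
      navSpray₂Nu, if_true, one_ne_zero, zero_ne_one, if_false, Pi.add_apply, Pi.mul_apply,
      Pi.sub_apply, Pi.pow_apply, Pi.neg_apply]
    unfold navMetricMu navMetricNu navHess
    clear hX0 hX1 hX00 hX01 hX10 hX11 hY000 hY001 hY010 hY011 hY100 hY101 hY110 hY111 hFxy hF0 hF1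
      hG00 hG01 hG10 hG11 hG0 hG1 hF
    generalize navMetric ε (x 0) (y 0) (y 1) = f at *
    generalize √(navForm ε (x 0) (y 0) (y 1)) = S at *
    clear h
    generalize x 0 = r at *
    generalize y 0 = μ at *
    generalize y 1 = ν at *
    push_cast
    field_simp
    obtain ⟨w, rfl⟩ : ∃ w, ν = w + ε * f := ⟨ν - ε * f, by ring⟩
    obtain ⟨a, rfl⟩ : ∃ a, μ = a - r * f := ⟨μ + r * f, by ring⟩
    have hS2 : S = f - r * a + ε * r ^ 2 * w := by linear_combination -hm
    have hf : f ^ 2 = a ^ 2 + r ^ 2 * w ^ 2 := by linear_combination hq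
    clear hq hm hS
    ring_nf at hS2 hf ⊢
    subst hS2
    grind

end Tensor

/-- The Randers metric on the disk `D²(1/√(1+ε²))` obtained from Zermelo
navigation on the Funk metric of the unit disk, in polar coordinates
`x = (r,θ)`, `y = (μ,ν)`, has constant flag curvature `K = −1/4`: its Riemann
curvature satisfies `R^i_k = −¼(F²δ^i_k − F(∂F/∂y^k)y^i)`. -/
theorem flag_curvature_neg_quarter_funk_navigation (ε : ℝ)
    (F : (Fin 2 → ℝ) → (Fin 2 → ℝ) → ℝ)
    (hF : F = fun x y =>
      (Real.sqrt ((y 0) ^ 2 + (x 0) ^ 2 * (y 1) ^ 2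
            - (x 0) ^ 2 * (x 0 * y 1 + ε * y 0) ^ 2)
          + x 0 * y 0 - ε * (x 0) ^ 2 * y 1) / (1 - (1 + ε ^ 2) * (x 0) ^ 2)) :
    ∀ x y : Fin 2 → ℝ, 0 < x 0 → x 0 < 1 / Real.sqrt (1 + ε ^ 2) → y ≠ 0 →
      0 < (y 0) ^ 2 + (x 0) ^ 2 * (y 1) ^ 2 - (x 0) ^ 2 * (x 0 * y 1 + ε * y 0) ^ 2 ∧
      0 < F x y ∧ (fundMatrix F x y).PosDef ∧
      ∀ i k : Fin 2, riemCoeff F i k x y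
        = -(1 / 4) * (F x y ^ 2 * (if i = k then 1 else 0)
            - F x y * pdy k F x y * y i) := by
  subst hF
  intro x y hx0 hx1 hy
  have hs : 0 < √(1 + ε ^ 2) := Real.sqrt_pos.2 (by positivity)
  have h : NavDomain ε (x 0) (y 0) (y 1) := by
    refine ⟨hx0, ?_, ?_⟩
    · have hlt : x 0 * √(1 + ε ^ 2) < 1 := (lt_div_iff₀ hs).1 hx1
      have hsq := pow_lt_one₀ (mul_pos hx0 hs).le hlt two_ne_zero
      rw [mul_pow, Real.sq_sqrt (by positivity)] at hsq
      linarith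
    · contrapose! hy
      ext i
      fin_cases i
      exacts [hy.1, hy.2]
  have hF : NavEq ε (fun x y : Fin 2 → ℝ =>
      (√((y 0) ^ 2 + (x 0) ^ 2 * (y 1) ^ 2 - (x 0) ^ 2 * (x 0 * y 1 + ε * y 0) ^ 2)
        + x 0 * y 0 - ε * (x 0) ^ 2 * y 1) / (1 - (1 + ε ^ 2) * (x 0) ^ 2)) (navMetric ε) :=
    fun _ _ _ => rfl
  exact ⟨navForm_pos h, navMetric_pos h, hF.fundMatrix_posDef h, hF.riemCoeff_eq h⟩
end

section
/- Fix ε ∈ ℝ and let p = (x,y) ∈ ℝ² satisfy 1 − ε²(x²+y²)(1+x²+y²) > 0, and let (u,v) ∈ ℝ² be nonzero. Then u² + v² + (2+x²+y²)(xv−yu)² − ε²(xu+yv)²(1+x²+y²) > 0, and the number F := α + β with α := √(u² + v² + (2+x²+y²)(xv−yu)² − ε²(xu+yv)²(1+x²+y²)) / (√(1+x²+y²)·(1 − ε²(x²+y²)(1+x²+y²))) and β := −ε(1+x²+y²)(xv−yu)/(1 − ε²(x²+y²)(1+x²+y²)) is positive and satisfies Φ((u,v)/F − ε(−y,x)) =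 1, where Φ(w₁,w₂) := √((w₁² + w₂² + (xw₂−yw₁)²)/(1+x²+y²) + (xw₂−yw₁)²). -/
/-- Zermelo navigation for the Riemannian metric
`Φ(w₁,w₂) = √((w₁²+w₂²+(xw₂−yw₁)²)/(1+x²+y²) + (xw₂−yw₁)²)` of constant Gauss
curvature `−4` with rotation field `v_p = (−y,x)` and parameter `ε`: the
explicit Randers metric `F = α + β` solves `Φ((u,v)/F − ε(−y,x)) = 1`. -/
theorem navigation_curvature_neg_four_metric (ε x y : ℝ)
    (hp : 0 < 1 - ε ^ 2 * (x ^ 2 + y ^ 2) * (1 + x ^ 2 + y ^ 2))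
    (u v : ℝ) (huv : (u, v) ≠ (0, 0)) (α β F : ℝ)
    (hα : α = Real.sqrt (u ^ 2 + v ^ 2 + (2 + x ^ 2 + y ^ 2) * (x * v - y * u) ^ 2
          - ε ^ 2 * (x * u + y * v) ^ 2 * (1 + x ^ 2 + y ^ 2))
        / (Real.sqrt (1 + x ^ 2 + y ^ 2)
          * (1 - ε ^ 2 * (x ^ 2 + y ^ 2) * (1 + x ^ 2 + y ^ 2))))
    (hβ : β = -(ε * (1 + x ^ 2 + y ^ 2) * (x * v - y * u))
        / (1 - ε ^ 2 * (x ^ 2 + y ^ 2) * (1 + x ^ 2 + y ^ 2)))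
    (hFαβ : F = α + β)
    (Φ : ℝ → ℝ → ℝ)
    (hΦ : Φ = fun w₁ w₂ => Real.sqrt
        ((w₁ ^ 2 + w₂ ^ 2 + (x * w₂ - y * w₁) ^ 2) / (1 + x ^ 2 + y ^ 2)
          + (x * w₂ - y * w₁) ^ 2)) :
    0 < u ^ 2 + v ^ 2 + (2 + x ^ 2 + y ^ 2) * (x * v - y * u) ^ 2
        - ε ^ 2 * (x * u + y * v) ^ 2 * (1 + x ^ 2 + y ^ 2) ∧
    0 < F ∧
    Φ (u / F - ε * (-y)) (v / F - ε * x) = 1 := by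
  have hs : 0 < 1 + x ^ 2 + y ^ 2 := by positivity
  have hw : 0 < u ^ 2 + v ^ 2 := by
    by_contra! h
    have hu : u = 0 := by nlinarith [sq_nonneg u, sq_nonneg v]
    have hv : v = 0 := by nlinarith [sq_nonneg u, sq_nonneg v]
    exact huv (by rw [hu, hv])
  have hN : 0 < u ^ 2 + v ^ 2 + (2 + x ^ 2 + y ^ 2) * (x * v - y * u) ^ 2 := by positivity
  set A := u ^ 2 + v ^ 2 + (2 + x ^ 2 + y ^ 2) * (x * v - y * u) ^ 2
    - ε ^ 2 * (x * u + y * v) ^ 2 * (1 + x ^ 2 + y ^ 2) with hA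
  set l := 1 - ε ^ 2 * (x ^ 2 + y ^ 2) * (1 + x ^ 2 + y ^ 2) with hl
  have key : A = (ε * (1 + x ^ 2 + y ^ 2) * (x * v - y * u)) ^ 2 * (1 + x ^ 2 + y ^ 2)
      + l * (u ^ 2 + v ^ 2 + (2 + x ^ 2 + y ^ 2) * (x * v - y * u) ^ 2) := by
    rw [hA, hl]; ring
  have hlN := mul_pos hp hN
  have hA0 : 0 < A := by rw [key]; positivity
  obtain ⟨t, ht⟩ : ∃ t, t = √A / √(1 + x ^ 2 + y ^ 2) := ⟨_, rfl⟩
  have ht0 : 0 < t := by rw [ht]; positivity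
  have ht2 : t ^ 2 * (1 + x ^ 2 + y ^ 2) = A := by
    rw [ht, div_pow, Real.sq_sqrt hA0.le, Real.sq_sqrt hs.le]
    field_simp
  have hlF : l * F = t - ε * (1 + x ^ 2 + y ^ 2) * (x * v - y * u) := by
    rw [hFαβ, hα, hβ, ht]
    field_simp
    ring
  have hlt : ε * (1 + x ^ 2 + y ^ 2) * (x * v - y * u) < t := by
    refine lt_of_pow_lt_pow_left₀ 2 ht0.le (lt_of_mul_lt_mul_right ?_ hs.le)
    linarith
  have hF : 0 < F := pos_of_mul_pos_right (by rw [hlF]; linarith) hp.le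
  refine ⟨hA0, hF, ?_⟩
  have hquad : (1 + x ^ 2 + y ^ 2) * (l * F ^ 2
      + 2 * (ε * (1 + x ^ 2 + y ^ 2) * (x * v - y * u)) * F)
      = u ^ 2 + v ^ 2 + (2 + x ^ 2 + y ^ 2) * (x * v - y * u) ^ 2 := by
    have ht3 : t = l * F + ε * (1 + x ^ 2 + y ^ 2) * (x * v - y * u) := by linarith
    refine mul_left_cancel₀ hp.ne' ?_
    rw [ht3, key] at ht2
    linear_combination ht2
  rw [hΦ]
  simp only [Real.sqrt_eq_one]
  field_simp
  rw [hl] at hquad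
  linear_combination -hquad
end
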